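/- Let M be a symmetric positive definite matrix partitioned in 2×2 block form with blocks W (t×t), X (t×(n−t)), Xᵀ, and Z ((n−t)×(n−t)). Then as η → ∞, the block of (M + η S Sᵀ)⁻¹ corresponding to the first t×t indices converges to W⁻¹, where S = [0; I_{n−t}] so that S Sᵀ adds η to the lower-right block. The off-diagonal and lower-right blocks of the inverse converge to 0. -/

import Mathlib

open Matrix Filter

theorem stmt_9 (t s : ℕ)
    (W : Matrix (Fin t) (Fin t) ℝ) (X : Matrix (Fin t) (Fin s) ℝ)
    (Z : Matrix (Fin s) (Fin s) ℝ)
    (M : Matrix (Fin t ⊕ Fin s) (Fin t ⊕ Fin s) ℝ)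
    (hM : M = Matrix.fromBlocks W X Xᵀ Z) (hMpd : M.PosDef) :
    Tendsto
      (fun η : ℝ =>
        (M + η • Matrix.fromBlocks (0 : Matrix (Fin t) (Fin t) ℝ) 0 0
          (1 : Matrix (Fin s) (Fin s) ℝ))⁻¹)
      atTop
      (nhds (Matrix.fromBlocks W⁻¹ 0 0 0)) := by
  have hW : W.PosDef := by
    have h := hMpd.submatrix (e := (Sum.inl : Fin t → Fin t ⊕ Fin s)) Sum.inl_injective
    have e : M.submatrix Sum.inl Sum.inl = W := by
      subst hM; ext i j; rfl
    rwa [e] at h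
  have hWu : IsUnit W.det := isUnit_iff_ne_zero.mpr hW.det_pos.ne'
  let N : ℝ → Matrix (Fin t ⊕ Fin s) (Fin t ⊕ Fin s) ℝ :=
    fun ε => fromBlocks W X (ε • Xᵀ) (ε • Z + 1)
  let D : ℝ → Matrix (Fin t ⊕ Fin s) (Fin t ⊕ Fin s) ℝ :=
    fun ε => fromBlocks 1 0 0 (ε • 1)
  have hN : Continuous N := by
    refine Continuous.matrix_fromBlocks ?_ ?_ ?_ ?_ <;> fun_prop
  have hD : Continuous D := by
    refine Continuous.matrix_fromBlocks ?_ ?_ ?_ ?_ <;> fun_prop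
  have hN0 : (N 0).det = W.det := by
    simp [N]
  have hNinv : (N 0)⁻¹ = fromBlocks W⁻¹ (-(W⁻¹ * X)) 0 1 := by
    apply inv_eq_right_inv
    simp [N, fromBlocks_multiply, ← Matrix.mul_assoc, Matrix.mul_nonsing_inv _ hWu]
  have hc : ContinuousAt (fun ε => (N ε)⁻¹ * D ε) 0 := by
    refine ContinuousAt.mul ?_ hD.continuousAt
    have h1 : ContinuousAt (fun ε => (N ε).det⁻¹ • (N ε).adjugate) 0 :=
      ((hN.matrix_det.continuousAt).inv₀ (by rw [hN0]; exact hWu.ne_zero)).smul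
        hN.matrix_adjugate.continuousAt
    simpa only [Matrix.inv_def, Ring.inverse_eq_inv'] using h1
  have hl : (N 0)⁻¹ * D 0 = fromBlocks W⁻¹ 0 0 0 := by
    rw [hNinv]; simp [D, fromBlocks_multiply]
  have ht := hc.tendsto.comp (tendsto_inv_atTop_zero (𝕜 := ℝ))
  rw [hl] at ht
  refine ht.congr' ?_
  filter_upwards [eventually_gt_atTop 0] with η hη
  have hη' : η ≠ 0 := hη.ne'
  have hDi : (D η)⁻¹ = D η⁻¹ := by
    apply inv_eq_right_inv
    simp [D, fromBlocks_multiply, smul_smul, hη']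
  have hf : M + η • fromBlocks (0 : Matrix (Fin t) (Fin t) ℝ) 0 0
      (1 : Matrix (Fin s) (Fin s) ℝ) = D η * N η⁻¹ := by
    subst hM
    simp [D, N, fromBlocks_multiply, fromBlocks_smul, fromBlocks_add, smul_smul, hη']
  rw [hf, Matrix.mul_inv_rev, hDi]
  rfl
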